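/- The Riemann theta function θ is an entire function of g complex variables: θ is complex differentiable (holomorphic) at every point of ℂ^g. -/

import Mathlib

open Complex Matrix

/-- The term of the Riemann theta series associated with `B`, indexed by `n ∈ ℤ^g`. -/
noncomputable def thetaTerm (g : ℕ) (B : Matrix (Fin g) (Fin g) ℂ)
    (u : Fin g → ℂ) (n : Fin g → ℤ) : ℂ :=
  Complex.exp (Real.pi * Complex.I * (∑ i, ∑ j, (n i : ℂ) * B i j * (n j : ℂ))
    + 2 * Real.pi * Complex.I * (∑ i, (n i : ℂ) * u i))

/-- The Riemann theta function associated with `B`. -/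
noncomputable def theta (g : ℕ) (B : Matrix (Fin g) (Fin g) ℂ) (u : Fin g → ℂ) : ℂ :=
  ∑' n : Fin g → ℤ, thetaTerm g B u n

/-- A positive definite real quadratic form is bounded below by a positive multiple of the
sum of squares. -/
lemma Matrix.PosDef.exists_pos_mul_sum_sq_le {ι : Type*} [Fintype ι] {M : Matrix ι ι ℝ}
    (hM : M.PosDef) :
    ∃ c : ℝ, 0 < c ∧ ∀ x : ι → ℝ, c * ∑ i, x i ^ 2 ≤ ∑ i, ∑ j, x i * M i j * x j := by
  have hQ (x : ι → ℝ) : x ⬝ᵥ (M *ᵥ x) = ∑ i, ∑ j, x i * M i j * x j := by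
    simp [dotProduct, mulVec, Finset.mul_sum, mul_assoc]
  have hcont : Continuous fun x : ι → ℝ ↦ x ⬝ᵥ (M *ᵥ x) := by
    simp_rw [hQ]
    fun_prop
  obtain ⟨m, hm, hle⟩ : ∃ m : ℝ, 0 < m ∧ ∀ x ∈ Metric.sphere (0 : ι → ℝ) 1,
      m ≤ x ⬝ᵥ (M *ᵥ x) := by
    rcases (Metric.sphere (0 : ι → ℝ) 1).eq_empty_or_nonempty with h | h
    · exact ⟨1, one_pos, by simp [h]⟩
    · obtain ⟨y, hy, hmin⟩ := (isCompact_sphere _ _).exists_isMinOn h hcont.continuousOn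
      refine ⟨_, ?_, fun x hx ↦ hmin hx⟩
      simpa using hM.dotProduct_mulVec_pos (ne_zero_of_mem_unit_sphere ⟨y, hy⟩)
  have hnorm (x : ι → ℝ) : m * ‖x‖ ^ 2 ≤ x ⬝ᵥ (M *ᵥ x) := by
    rcases eq_or_ne x 0 with rfl | hx
    · simp
    have hx' : 0 < ‖x‖ := norm_pos_iff.mpr hx
    have h := hle (‖x‖⁻¹ • x) (by simp [norm_smul, hx'.ne'])
    rw [mulVec_smul, dotProduct_smul, smul_dotProduct, smul_eq_mul, smul_eq_mul] at h
    calc m * ‖x‖ ^ 2 ≤ (‖x‖⁻¹ * (‖x‖⁻¹ * (x ⬝ᵥ (M *ᵥ x)))) * ‖x‖ ^ 2 := by gcongr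
      _ = x ⬝ᵥ (M *ᵥ x) := by field_simp
  have hsum (x : ι → ℝ) : ∑ i, x i ^ 2 ≤ (Fintype.card ι + 1) * ‖x‖ ^ 2 := by
    calc ∑ i, x i ^ 2 ≤ ∑ _i : ι, ‖x‖ ^ 2 := by
          refine Finset.sum_le_sum fun i _ ↦ ?_
          rw [← sq_abs]
          exact pow_le_pow_left₀ (abs_nonneg _) (norm_le_pi_norm x i) 2
      _ ≤ _ := by simp [add_mul]
  refine ⟨m / (Fintype.card ι + 1), by positivity, fun x ↦ ?_⟩
  rw [← hQ]
  refine le_trans ?_ (hnorm x)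
  calc m / (Fintype.card ι + 1) * ∑ i, x i ^ 2
      ≤ m / (Fintype.card ι + 1) * ((Fintype.card ι + 1) * ‖x‖ ^ 2) := by gcongr; exact hsum x
    _ = m * ‖x‖ ^ 2 := by field_simp

lemma summable_pi_prod_of_nonneg {ι α : Type*} [Fintype ι] {f : α → ℝ}
    (hf : ∀ a, 0 ≤ f a) (hs : Summable f) : Summable fun n : ι → α ↦ ∏ i, f (n i) := by
  classical
  refine summable_of_sum_le (fun n ↦ Finset.prod_nonneg fun i _ ↦ hf _)
    (c := ∏ _i : ι, ∑' a, f a) fun s ↦ ?_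
  calc ∑ n ∈ s, ∏ i, f (n i)
      ≤ ∑ n ∈ Fintype.piFinset fun i ↦ s.image fun n ↦ n i, ∏ i, f (n i) := by
        refine Finset.sum_le_sum_of_subset_of_nonneg (fun n hn ↦ ?_)
          fun n _ _ ↦ Finset.prod_nonneg fun i _ ↦ hf _
        exact Fintype.mem_piFinset.mpr fun i ↦ Finset.mem_image_of_mem _ hn
    _ = ∏ i, ∑ a ∈ s.image fun n ↦ n i, f a := (Finset.prod_univ_sum _ _).symm
    _ ≤ ∏ _i : ι, ∑' a, f a :=
        Finset.prod_le_prod (fun i _ ↦ Finset.sum_nonneg fun a _ ↦ hf a)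
          fun i _ ↦ hs.sum_le_tsum _ fun a _ ↦ hf a

lemma summable_prod_exp_neg_sq {ι : Type*} [Fintype ι] (S : ℝ) {c : ℝ} (hc : 0 < c) :
    Summable fun n : ι → ℤ ↦ ∏ i, Real.exp (-Real.pi * (c * n i ^ 2 - 2 * S * |n i|)) :=
  summable_pi_prod_of_nonneg (f := fun k : ℤ ↦ Real.exp (-Real.pi * (c * k ^ 2 - 2 * S * |k|)))
    (fun _ ↦ (Real.exp_pos _).le)
    (by simpa using summable_pow_mul_jacobiTheta₂_term_bound S hc 0)

lemma norm_thetaTerm (g : ℕ) (B : Matrix (Fin g) (Fin g) ℂ) (u : Fin g → ℂ) (n : Fin g → ℤ) :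
    ‖thetaTerm g B u n‖ = Real.exp (-Real.pi * (∑ i, ∑ j, (n i : ℝ) * (B i j).im * n j)
      - 2 * Real.pi * ∑ i, (n i : ℝ) * (u i).im) := by
  rw [thetaTerm, Complex.norm_exp]
  simp [Complex.im_sum, sub_eq_add_neg]

lemma norm_thetaTerm_le {g : ℕ} {B : Matrix (Fin g) (Fin g) ℂ} {c : ℝ}
    (hB : ∀ x : Fin g → ℝ, c * ∑ i, x i ^ 2 ≤ ∑ i, ∑ j, x i * (B i j).im * x j)
    {u : Fin g → ℂ} {R : ℝ} (hu : ‖u‖ ≤ R) (n : Fin g → ℤ) :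
    ‖thetaTerm g B u n‖ ≤ ∏ i, Real.exp (-Real.pi * (c * n i ^ 2 - 2 * R * |n i|)) := by
  rw [norm_thetaTerm, ← Real.exp_sum, Real.exp_le_exp]
  have h1 := hB fun i ↦ (n i : ℝ)
  have h2 : -∑ i, (n i : ℝ) * (u i).im ≤ ∑ i, R * |(n i : ℝ)| := by
    rw [← Finset.sum_neg_distrib]
    refine Finset.sum_le_sum fun i _ ↦ ?_
    calc -((n i : ℝ) * (u i).im) ≤ |(n i : ℝ) * (u i).im| := neg_le_abs _
      _ = |(u i).im| * |(n i : ℝ)| := by rw [abs_mul, mul_comm]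
      _ ≤ R * |(n i : ℝ)| := by
        gcongr
        exact (Complex.abs_im_le_norm _).trans ((norm_le_pi_norm u i).trans hu)
  have h3 : ∑ i, -Real.pi * (c * (n i : ℝ) ^ 2 - 2 * R * |(n i : ℝ)|)
      = -Real.pi * (c * ∑ i, (n i : ℝ) ^ 2) + 2 * Real.pi * ∑ i, R * |(n i : ℝ)| := by
    simp only [Finset.mul_sum, ← Finset.sum_add_distrib]
    exact Finset.sum_congr rfl fun i _ ↦ by ring
  push_cast
  rw [h3]
  nlinarith [Real.pi_pos, mul_le_mul_of_nonneg_left h1 Real.pi_pos.le,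
    mul_le_mul_of_nonneg_left h2 Real.pi_pos.le]

/-- The derivative of `thetaTerm` in the variable `u`. -/
noncomputable def thetaTermFDeriv (g : ℕ) (B : Matrix (Fin g) (Fin g) ℂ)
    (u : Fin g → ℂ) (n : Fin g → ℤ) : (Fin g → ℂ) →L[ℂ] ℂ :=
  thetaTerm g B u n • ((2 * Real.pi * Complex.I : ℂ) •
    ∑ i, (n i : ℂ) • ContinuousLinearMap.proj (R := ℂ) (φ := fun _ : Fin g ↦ ℂ) i)

lemma hasFDerivAt_thetaTerm (g : ℕ) (B : Matrix (Fin g) (Fin g) ℂ)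
    (u : Fin g → ℂ) (n : Fin g → ℤ) :
    HasFDerivAt (fun v ↦ thetaTerm g B v n) (thetaTermFDeriv g B u n) u :=
  (((HasFDerivAt.fun_sum fun i _ ↦ (hasFDerivAt_apply i u).const_mul (n i : ℂ)).const_mul
    (2 * Real.pi * Complex.I : ℂ)).const_add _).cexp

lemma norm_thetaTermFDeriv_le {g : ℕ} {B : Matrix (Fin g) (Fin g) ℂ} {c : ℝ}
    (hB : ∀ x : Fin g → ℝ, c * ∑ i, x i ^ 2 ≤ ∑ i, ∑ j, x i * (B i j).im * x j)
    {u : Fin g → ℂ} {R : ℝ} (hu : ‖u‖ ≤ R) (n : Fin g → ℤ) :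
    ‖thetaTermFDeriv g B u n‖ ≤
      ∏ i, Real.exp (-Real.pi * (c * n i ^ 2 - 2 * (R + 1) * |n i|)) := by
  have hproj : ‖(2 * Real.pi * Complex.I : ℂ) • ∑ i, (n i : ℂ) •
      ContinuousLinearMap.proj (R := ℂ) (φ := fun _ : Fin g ↦ ℂ) i‖
      ≤ ∏ i, Real.exp (2 * Real.pi * |n i|) := by
    rw [← Real.exp_sum, ← Finset.mul_sum, norm_smul]
    refine le_trans ?_ ((le_add_of_nonneg_right zero_le_one).trans (Real.add_one_le_exp _))
    have h2 : ‖(2 * Real.pi * Complex.I : ℂ)‖ = 2 * Real.pi := by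
      simp [abs_of_pos Real.pi_pos]
    rw [h2]
    refine mul_le_mul_of_nonneg_left ((norm_sum_le _ _).trans ?_) Real.two_pi_pos.le
    refine Finset.sum_le_sum fun i _ ↦ ?_
    rw [norm_smul, Complex.norm_intCast, Int.cast_abs]
    refine mul_le_of_le_one_right (abs_nonneg _) ?_
    exact ContinuousLinearMap.opNorm_le_bound _ zero_le_one fun v ↦ by
      simpa using norm_le_pi_norm v i
  rw [thetaTermFDeriv, norm_smul]
  refine (mul_le_mul (norm_thetaTerm_le hB hu n) hproj (norm_nonneg _)
    (Finset.prod_nonneg fun i _ ↦ (Real.exp_pos _).le)).trans_eq ?_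
  rw [← Finset.prod_mul_distrib]
  refine Finset.prod_congr rfl fun i _ ↦ ?_
  rw [← Real.exp_add]
  ring_nf

/-- the Riemann theta function is entire: it is complex differentiable
at every point of `ℂ^g`. -/
theorem theta_differentiable (g : ℕ) (hg : 0 < g) (B : Matrix (Fin g) (Fin g) ℂ)
    (hBsymm : B.IsSymm) (hBim : (B.map Complex.im).PosDef) :
    Differentiable ℂ (theta g B) := by
  obtain ⟨c, hc, hB⟩ := hBim.exists_pos_mul_sum_sq_le
  simp only [map_apply] at hB
  intro u
  have hball {v : Fin g → ℂ} (hv : v ∈ Metric.ball 0 (‖u‖ + 1)) : ‖v‖ ≤ ‖u‖ + 1 :=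
    (mem_ball_zero_iff.mp hv).le
  have hu : u ∈ Metric.ball (0 : Fin g → ℂ) (‖u‖ + 1) := by simp
  exact (hasFDerivAt_tsum_of_isPreconnected (summable_prod_exp_neg_sq (‖u‖ + 1 + 1) hc)
    Metric.isOpen_ball (convex_ball _ _).isPreconnected
    (fun n v _ ↦ hasFDerivAt_thetaTerm g B v n)
    (fun n v hv ↦ norm_thetaTermFDeriv_le hB (hball hv) n) hu
    (.of_norm_bounded (summable_prod_exp_neg_sq (‖u‖ + 1) hc)
      fun n ↦ norm_thetaTerm_le hB (hball hu) n) hu).differentiableAt
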